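/- Let φ₀ = dx¹∧dy²∧dy³ + dx²∧dy³∧dy¹ + dx³∧dy¹∧dy² on ℝ⁶ with coordinates (x¹,x²,x³,y¹,y²,y³) and vol = dx¹∧dy¹∧dx²∧dy²∧dx³∧dy³. Then F(φ₀) = 4 dy¹∧dy²∧dy³ (after trivializing by vol), and in particular Q(φ₀) = 0. -/

import Mathlib

noncomputable section

/-- The model 6-dimensional real vector space. -/
abbrev V6 := Fin 6 → ℝ

/-- Alternating k-forms on V6. -/
abbrev Form (k : ℕ) := AlternatingMap ℝ V6 ℝ (Fin k)

/-- Wedge product of alternating forms (determinant convention). -/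
noncomputable def wedge {a b : ℕ} (φ : Form a) (ψ : Form b) : Form (a + b) :=
  AlternatingMap.domDomCongr finSumFinEquiv
    ((TensorProduct.lid ℝ ℝ).toLinearMap.compAlternatingMap (AlternatingMap.domCoprod φ ψ))

infixl:70 " ⋏ " => wedge

/-- Interior product (contraction) of a form with a vector. -/
noncomputable def iota (v : V6) {k : ℕ} (φ : Form (k + 1)) : Form k :=
  AlternatingMap.curryLeft φ v

/-- The standard dual basis 1-forms e¹, …, e⁶ (0-indexed). -/
noncomputable def e (i : Fin 6) : Form 1 :=
  AlternatingMap.ofSubsingleton ℝ V6 ℝ 0 (LinearMap.proj i)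

/-- The standard basis vectors e₁, …, e₆ (0-indexed). -/
def b (i : Fin 6) : V6 := Pi.single i 1

/-- The standard volume form e¹∧e²∧e³∧e⁴∧e⁵∧e⁶. -/
noncomputable def vol : Form 6 := e 0 ⋏ e 1 ⋏ e 2 ⋏ e 3 ⋏ e 4 ⋏ e 5

-- Coordinates (x¹,y¹,x²,y²,x³,y³) on ℝ⁶: dx^j = e (2j-2), dy^j = e (2j-1) (0-indexed),
-- so that vol = dx¹∧dy¹∧dx²∧dy²∧dx³∧dy³ is the standard volume form.

/-- The product of `k` coordinate functions, as a multilinear map. -/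
def coordProd {k : ℕ} (f : Fin k → Fin 6) : MultilinearMap ℝ (fun _ : Fin k => V6) ℝ :=
  (MultilinearMap.mkPiAlgebra ℝ (Fin k) ℝ).compLinearMap fun i => LinearMap.proj (f i)

/-- The monomial form `e (f 0) ⋏ ⋯ ⋏ e (f (k - 1))`. -/
def monomialForm {k : ℕ} (f : Fin k → Fin 6) : Form k :=
  MultilinearMap.alternatization (coordProd f)

lemma monomialForm_apply {k : ℕ} (f : Fin k → Fin 6) (v : Fin k → V6) :
    monomialForm f v = Matrix.det (Matrix.of fun i j => v i (f j)) := by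
  simp [monomialForm, coordProd, MultilinearMap.alternatization_apply, Matrix.det_apply]

lemma monomialForm_eq_zero {k : ℕ} {f : Fin k → Fin 6} {i j : Fin k} (hij : i ≠ j)
    (h : f i = f j) : monomialForm f = 0 := by
  ext v
  rw [monomialForm_apply]
  exact Matrix.det_zero_of_column_eq hij fun l => by simp [h]

lemma e_eq_monomialForm (i : Fin 6) : e i = monomialForm ![i] := by
  ext v
  simp [monomialForm_apply, e]

lemma monomialForm_wedge {k l : ℕ} (f : Fin k → Fin 6) (g : Fin l → Fin 6) :
    monomialForm f ⋏ monomialForm g = monomialForm (Fin.append f g) := by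
  ext v
  rw [wedge, monomialForm, monomialForm, ← MultilinearMap.domCoprod_alternization]
  rw [monomialForm_apply, ← Matrix.det_submatrix_equiv_self finSumFinEquiv]
  simp [MultilinearMap.alternatization_apply, Matrix.det_apply, coordProd]

lemma add_wedge {k l : ℕ} (α β : Form k) (γ : Form l) : (α + β) ⋏ γ = α ⋏ γ + β ⋏ γ := by
  ext v
  simp [wedge, ← AlternatingMap.domCoprod'_apply, TensorProduct.add_tmul]

lemma wedge_add {k l : ℕ} (α : Form k) (β γ : Form l) : α ⋏ (β + γ) = α ⋏ β + α ⋏ γ := by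
  ext v
  simp [wedge, ← AlternatingMap.domCoprod'_apply, TensorProduct.tmul_add]

lemma smul_wedge {k l : ℕ} (c : ℝ) (α : Form k) (γ : Form l) : (c • α) ⋏ γ = c • (α ⋏ γ) := by
  ext v
  simp [wedge, ← AlternatingMap.domCoprod'_apply, ← TensorProduct.smul_tmul']

lemma wedge_smul {k l : ℕ} (c : ℝ) (α : Form k) (γ : Form l) : α ⋏ (c • γ) = c • (α ⋏ γ) := by
  ext v
  simp [wedge, ← AlternatingMap.domCoprod'_apply]

lemma e_wedge_e_wedge_e (i j l : Fin 6) : e i ⋏ e j ⋏ e l = monomialForm ![i, j, l] := by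
  simp only [e_eq_monomialForm, monomialForm_wedge]
  congr 1
  ext m
  fin_cases m <;> rfl

lemma vol_eq_monomialForm : vol = monomialForm id := by
  simp only [vol, e_eq_monomialForm, monomialForm_wedge]
  congr 1
  ext m
  fin_cases m <;> rfl

lemma iota_monomialForm (v : V6) (i j l : Fin 6) :
    iota v (monomialForm ![i, j, l]) =
      v i • monomialForm ![j, l] + v j • monomialForm ![l, i] + v l • monomialForm ![i, j] := by
  ext w
  simp [iota, monomialForm_apply, Matrix.det_fin_three, Matrix.det_fin_two]
  ring

/-- The value of a monomial form on standard basis vectors, by Laplace expansion. -/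
def pairing : {k : ℕ} → (Fin k → Fin 6) → (Fin k → Fin 6) → ℤ
  | 0, _, _ => 1
  | _ + 1, f, g => ∑ j, if g 0 = f j then
      (-1) ^ (j : ℕ) * pairing (fun l => f (j.succAbove l)) (fun l => g l.succ) else 0

lemma monomialForm_apply_b {k : ℕ} (f g : Fin k → Fin 6) :
    monomialForm f (fun i => b (g i)) = pairing f g := by
  induction k with
  | zero => simp [monomialForm_apply, pairing]
  | succ k ih =>
    rw [monomialForm_apply, pairing, Matrix.det_succ_row_zero]
    push_cast
    refine Finset.sum_congr rfl fun j _ => ?_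
    rw [← ih, monomialForm_apply]
    by_cases h : g 0 = f j
    · simp [b, h, Matrix.submatrix]
    · simp [b, h, Ne.symm h]

lemma iota_vol_apply (w : V6) (m : Fin 6) :
    iota w vol (fun i => b (m.succAbove i)) = (-1) ^ (m : ℕ) * w m := by
  have h : iota w vol (fun i => b (m.succAbove i)) =
      Matrix.det (Matrix.of (Matrix.vecCons w fun i => b (m.succAbove i))) := by
    rw [vol_eq_monomialForm, iota, AlternatingMap.curryLeft_apply_apply, monomialForm_apply]
    rfl
  rw [h, Matrix.det_succ_row_zero, Finset.sum_eq_single m]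
  · have h1 : (Matrix.of (Matrix.vecCons w fun i => b (m.succAbove i))).submatrix
        Fin.succ m.succAbove = 1 := by
      ext i j
      simp [b, Pi.single_apply, Matrix.one_apply, eq_comm]
    rw [h1]
    simp
  · intro j _ hj
    obtain ⟨i, rfl⟩ := Fin.exists_succAbove_eq hj
    rw [Matrix.det_eq_zero_of_row_eq_zero i, mul_zero]
    intro l
    simp [b, Fin.succAbove_ne]
  · simp

/-- The index triples of the three monomials of the normal form. -/
def normalFormIndex : Fin 3 → Fin 3 → Fin 6 := ![![0, 3, 5], ![2, 5, 1], ![4, 1, 3]]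

/-- The coefficients of `iota (b i) φ ⋏ φ` for the normal form `φ`, computed over the integers. -/
def normalFormCoeff (i m : Fin 6) : ℤ :=
  ∑ r, ∑ s, ∑ c, if normalFormIndex s c = i then
    pairing (Fin.append ![normalFormIndex s (c + 1), normalFormIndex s (c + 2)]
      (normalFormIndex r)) m.succAbove else 0

lemma normalFormCoeff_eq (i m : Fin 6) :
    (-1) ^ (m : ℕ) * normalFormCoeff i m = if m.val % 2 = 0 ∧ i = m + 1 then 2 else 0 := by
  revert i m
  decide +kernel

lemma sum_wedge {k l : ℕ} {ι : Type*} (s : Finset ι) (α : ι → Form k) (γ : Form l) :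
    (∑ i ∈ s, α i) ⋏ γ = ∑ i ∈ s, α i ⋏ γ :=
  map_sum (⟨⟨fun α => α ⋏ γ, fun _ _ => add_wedge _ _ _⟩, fun _ _ => smul_wedge _ _ _⟩ :
    Form k →ₗ[ℝ] Form (k + l)) α s

lemma wedge_sum {k l : ℕ} {ι : Type*} (s : Finset ι) (α : Form k) (γ : ι → Form l) :
    α ⋏ (∑ i ∈ s, γ i) = ∑ i ∈ s, α ⋏ γ i :=
  map_sum (⟨⟨fun γ => α ⋏ γ, fun _ _ => wedge_add _ _ _⟩, fun _ _ => wedge_smul _ _ _⟩ :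
    Form l →ₗ[ℝ] Form (k + l)) γ s

lemma form_sum_apply {k : ℕ} {ι : Type*} (s : Finset ι) (α : ι → Form k) (v : Fin k → V6) :
    (∑ i ∈ s, α i) v = ∑ i ∈ s, α i v :=
  map_sum (⟨⟨fun α => α v, fun _ _ => rfl⟩, fun _ _ => rfl⟩ : Form k →ₗ[ℝ] ℝ) α s

lemma iota_vol_apply_eq_neg {φ : Form 3} {v w : V6} (h : iota w vol = -(iota v φ ⋏ φ))
    (u : Fin 5 → V6) : iota w vol u = -(iota v φ ⋏ φ) u := by
  rw [h]
  rfl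

lemma normalForm_eq_sum : e 0 ⋏ e 3 ⋏ e 5 + e 2 ⋏ e 5 ⋏ e 1 + e 4 ⋏ e 1 ⋏ e 3 =
    ∑ s, monomialForm (normalFormIndex s) := by
  simp [e_wedge_e_wedge_e, Fin.sum_univ_three, normalFormIndex]

lemma iota_normalForm (v : V6) : iota v (∑ s, monomialForm (normalFormIndex s)) =
    ∑ s, ∑ c, v (normalFormIndex s c) •
      monomialForm ![normalFormIndex s (c + 1), normalFormIndex s (c + 2)] := by
  have h (s : Fin 3) : iota v (monomialForm (normalFormIndex s)) =
      ∑ c, v (normalFormIndex s c) •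
        monomialForm ![normalFormIndex s (c + 1), normalFormIndex s (c + 2)] := by
    have h3 : normalFormIndex s =
        ![normalFormIndex s 0, normalFormIndex s 1, normalFormIndex s 2] := by
      ext c
      fin_cases c <;> rfl
    conv_lhs => rw [h3]
    rw [iota_monomialForm, Fin.sum_univ_three]
    rfl
  rw [← Finset.sum_congr rfl fun s _ => h s]
  simp [iota, Fin.sum_univ_three]

lemma iota_wedge_normalForm_apply {φ : Form 3} (hφ : φ = ∑ s, monomialForm (normalFormIndex s))
    (i m : Fin 6) :
    (iota (b i) φ ⋏ φ) (fun j => b (m.succAbove j)) = normalFormCoeff i m := by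
  subst hφ
  rw [iota_normalForm]
  simp only [sum_wedge, smul_wedge, wedge_sum, monomialForm_wedge, normalFormCoeff]
  rw [form_sum_apply]
  push_cast
  refine Finset.sum_congr rfl fun r _ => ?_
  rw [form_sum_apply]
  refine Finset.sum_congr rfl fun s _ => ?_
  rw [form_sum_apply]
  refine Finset.sum_congr rfl fun c _ => ?_
  rw [AlternatingMap.smul_apply, monomialForm_apply_b (k := 2 + 3) _ m.succAbove]
  simp [b, Pi.single_apply]

/-- For φ₀ = dx¹∧dy²∧dy³ + dx²∧dy³∧dy¹ + dx³∧dy¹∧dy² with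
vol = dx¹∧dy¹∧dx²∧dy²∧dx³∧dy³: F(φ₀) = 4 dy¹∧dy²∧dy³ (after trivializing by vol),
and in particular Q(φ₀) = 0. -/
theorem F_and_Q_of_O0plus_normal_form (φ F : Form 3) (K : V6 →ₗ[ℝ] V6) (Q : ℝ)
    (hφ : φ = e 0 ⋏ e 3 ⋏ e 5 + e 2 ⋏ e 5 ⋏ e 1 + e 4 ⋏ e 1 ⋏ e 3)
    (hK : ∀ v : V6, iota (K v) vol = -(iota v φ ⋏ φ))
    (hF : ∀ v : V6, iota v F = (-2 : ℝ) • iota (K v) φ)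
    (hQ : (φ ⋏ F : Form 6) = (-Q) • vol) :
    F = (4 : ℝ) • (e 1 ⋏ e 3 ⋏ e 5) ∧ Q = 0 := by
  have hKb (i m : Fin 6) : K (b i) m = if m.val % 2 = 0 ∧ i = m + 1 then -2 else 0 := by
    have h : (-1) ^ (m : ℕ) * K (b i) m = -(normalFormCoeff i m : ℝ) := by
      have hb := iota_wedge_normalForm_apply (hφ.trans normalForm_eq_sum) i m
      have hi := iota_vol_apply_eq_neg (hK (b i)) fun j => b (m.succAbove j)
      rw [← hb, ← hi, iota_vol_apply]
    have hc : ((-1) ^ (m : ℕ) * normalFormCoeff i m : ℝ) =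
        if m.val % 2 = 0 ∧ i = m + 1 then 2 else 0 := by
      exact_mod_cast congrArg (Int.cast : ℤ → ℝ) (normalFormCoeff_eq i m)
    have hs : ((-1 : ℝ) ^ (m : ℕ)) * (-1) ^ (m : ℕ) = 1 := by
      rw [← mul_pow]; simp
    calc K (b i) m = (-1 : ℝ) ^ (m : ℕ) * ((-1) ^ (m : ℕ) * K (b i) m) := by
          rw [← mul_assoc, hs, one_mul]
      _ = -((-1) ^ (m : ℕ) * normalFormCoeff i m : ℝ) := by rw [h]; ring
      _ = _ := by rw [hc]; split_ifs <;> simp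
  have hKv (v : V6) : K v = ![-2 * v 1, 0, -2 * v 3, 0, -2 * v 5, 0] := by
    have hv : v = ∑ i, v i • b i := by
      ext j
      simp [b, Pi.single_apply]
    ext m
    rw [hv]
    simp only [map_sum, map_smul, Finset.sum_apply, Pi.smul_apply, hKb, smul_eq_mul]
    fin_cases m <;> simp [b, Pi.single_apply, mul_comm]
  have hFeq : F = (4 : ℝ) • (e 1 ⋏ e 3 ⋏ e 5) := by
    ext w
    have h : F (Matrix.vecCons (w 0) (Matrix.vecTail w)) =
        -2 * φ (Matrix.vecCons (K (w 0)) (Matrix.vecTail w)) :=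
      DFunLike.congr_fun (hF (w 0)) (Matrix.vecTail w)
    have hw : Matrix.vecCons (w 0) (Matrix.vecTail w) = w := Matrix.cons_head_tail w
    rw [hw] at h
    rw [h, hφ, hKv]
    simp only [e_wedge_e_wedge_e, AlternatingMap.add_apply, AlternatingMap.smul_apply,
      monomialForm_apply, Matrix.det_fin_three]
    simp [Matrix.vecTail]
    ring
  refine ⟨hFeq, ?_⟩
  have hzero : φ ⋏ F = 0 := by
    rw [hFeq, hφ]
    simp only [e_wedge_e_wedge_e, wedge_smul, add_wedge, monomialForm_wedge]
    rw [monomialForm_eq_zero (f := Fin.append ![0, 3, 5] _) (i := 1) (j := 4) (by decide) rfl,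
      monomialForm_eq_zero (f := Fin.append ![2, 5, 1] _) (i := 2) (j := 3) (by decide) rfl,
      monomialForm_eq_zero (f := Fin.append ![4, 1, 3] _) (i := 1) (j := 3) (by decide) rfl]
    simp
  have hvol : vol b = 1 := by
    rw [vol_eq_monomialForm, monomialForm_apply]
    convert Matrix.det_one (n := Fin 6) (R := ℝ)
    ext i j
    simp [b, Pi.single_apply, Matrix.one_apply, eq_comm]
  have h : (0 : ℝ) = -Q * vol b := DFunLike.congr_fun (hzero.symm.trans hQ) b
  rw [hvol] at h
  linarith
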